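/- Let X_1,…,X_{K+1} be mutually independent finitely-valued random variables and let (X_1,…,X_{K+1},Z) be jointly distributed, with 𝒦 = {1,…,K}. Let S, S₁ ⊆ 𝒦, S′ ⊆ S, S₁′ ⊆ S₁, and define Δ₁ = S′∩(S∖S₁) and Δ₂ = (S′∩S₁)∖S₁′. Then I(X_{S₁′∪Δ₁∪Δ₂∪{K+1}};Z) ≥ I(X_{Δ₁∪Δ₂∪{K+1}};Z|X_{S′∖(Δ₁∪Δ₂)}) + I(X_{S₁′};Z). -/

import Mathlib

open scoped Classical

noncomputable section

/-- Probability that random variable `X` takes value `x`, under pmf `p` on a finite sample space. -/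
def probOf {Ω α : Type} [Fintype Ω] (p : Ω → ℝ) (X : Ω → α) (x : α) : ℝ :=
  ∑ ω, if X ω = x then p ω else 0

/-- Shannon entropy of a finitely-valued random variable. -/
def Hent {Ω α : Type} [Fintype Ω] [Fintype α] (p : Ω → ℝ) (X : Ω → α) : ℝ :=
  -∑ x, probOf p X x * Real.log (probOf p X x)

/-- Conditional entropy `H(X | C)`. -/
def condHent {Ω α γ : Type} [Fintype Ω] [Fintype α] [Fintype γ]
    (p : Ω → ℝ) (X : Ω → α) (C : Ω → γ) : ℝ :=
  Hent p (fun ω => (X ω, C ω)) - Hent p C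

/-- Conditional mutual information `I(A;B | C)`. -/
def IcondMut {Ω α β γ : Type} [Fintype Ω] [Fintype α] [Fintype β] [Fintype γ]
    (p : Ω → ℝ) (A : Ω → α) (B : Ω → β) (C : Ω → γ) : ℝ :=
  condHent p A C + condHent p B C - condHent p (fun ω => (A ω, B ω)) C

/-- Mutual information `I(A;B)`. -/
def Imut {Ω α β : Type} [Fintype Ω] [Fintype α] [Fintype β]
    (p : Ω → ℝ) (A : Ω → α) (B : Ω → β) : ℝ :=
  Hent p A + Hent p B - Hent p (fun ω => (A ω, B ω))

/-- `p` is a probability mass function. -/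
def IsPMF {Ω : Type} [Fintype Ω] (p : Ω → ℝ) : Prop :=
  (∀ ω, 0 ≤ p ω) ∧ ∑ ω, p ω = 1

/-- The tuple `X_S = (X_k)_{k ∈ S}` as a random variable. -/
def tup {Ω ι : Type} {𝒳 : ι → Type} (X : ∀ k, Ω → 𝒳 k) (S : Finset ι) :
    Ω → ∀ k : S, 𝒳 k.1 :=
  fun ω k => X k.1 ω

/-- The random variables `X_1, …, X_K` are mutually independent. -/
def MutIndep {Ω ι : Type} [Fintype Ω] [Fintype ι] {𝒳 : ι → Type} [∀ k, Fintype (𝒳 k)]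
    (p : Ω → ℝ) (X : ∀ k, Ω → 𝒳 k) : Prop :=
  ∀ x : ∀ k, 𝒳 k, probOf p (fun ω k => X k ω) x = ∏ k, probOf p (X k) (x k)

/-- Expectation of a function of `X`, computed on the sample space. -/
theorem sum_probOf_mul {Ω α : Type} [Fintype Ω] [Fintype α] (p : Ω → ℝ) (X : Ω → α) (f : α → ℝ) :
    ∑ x, probOf p X x * f x = ∑ ω, p ω * f (X ω) := by
  simp only [probOf, Finset.sum_mul]
  rw [Finset.sum_comm]
  refine Finset.sum_congr rfl fun ω _ => ?_
  simp [ite_mul]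

theorem Hent_eq_sum {Ω α : Type} [Fintype Ω] [Fintype α] (p : Ω → ℝ) (X : Ω → α) :
    Hent p X = -∑ ω, p ω * Real.log (probOf p X (X ω)) := by
  rw [Hent, sum_probOf_mul p X fun x => Real.log (probOf p X x)]

/-- Entropy only depends on the partition of the sample space generated by the variable. -/
theorem Hent_congr {Ω α β : Type} [Fintype Ω] [Fintype α] [Fintype β] (p : Ω → ℝ)
    {X : Ω → α} {Y : Ω → β} (h : ∀ ω ω', X ω = X ω' ↔ Y ω = Y ω') : Hent p X = Hent p Y := by
  simp only [Hent_eq_sum, probOf, h]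

theorem probOf_nonneg {Ω α : Type} [Fintype Ω] {p : Ω → ℝ} (hp : ∀ ω, 0 ≤ p ω) (X : Ω → α)
    (x : α) : 0 ≤ probOf p X x :=
  Finset.sum_nonneg fun ω _ => by split_ifs <;> simp [hp]

theorem probOf_apply_pos {Ω α : Type} [Fintype Ω] {p : Ω → ℝ} (hp : ∀ ω, 0 ≤ p ω) (X : Ω → α)
    {ω : Ω} (hω : 0 < p ω) : 0 < probOf p X (X ω) :=
  Finset.sum_pos' (fun ω _ => by split_ifs <;> simp [hp]) ⟨ω, Finset.mem_univ _, by simpa⟩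

theorem sum_probOf {Ω α : Type} [Fintype Ω] [Fintype α] (p : Ω → ℝ) (X : Ω → α) :
    ∑ x, probOf p X x = ∑ ω, p ω := by
  simpa using sum_probOf_mul p X fun _ => 1

theorem sum_probOf_prodMk {Ω α γ : Type} [Fintype Ω] [Fintype α] (p : Ω → ℝ)
    (A : Ω → α) (C : Ω → γ) (c : γ) :
    ∑ a, probOf p (fun ω => (A ω, C ω)) (a, c) = probOf p C c := by
  simp only [probOf]
  rw [Finset.sum_comm]
  refine Finset.sum_congr rfl fun ω _ => ?_
  by_cases h : C ω = c <;> simp [h]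

/-- Strong subadditivity of the Shannon entropy. -/
theorem Hent_submodular {Ω α β γ : Type} [Fintype Ω] [Fintype α] [Fintype β] [Fintype γ]
    {p : Ω → ℝ} (hp : IsPMF p) (A : Ω → α) (B : Ω → β) (C : Ω → γ) :
    Hent p (fun ω => (A ω, B ω, C ω)) + Hent p C ≤
      Hent p (fun ω => (A ω, C ω)) + Hent p (fun ω => (B ω, C ω)) := by
  set q := probOf p (fun ω => (A ω, B ω, C ω)) with hq
  set r := probOf p C with hr
  set s := probOf p (fun ω => (A ω, C ω)) with hs
  set t := probOf p (fun ω => (B ω, C ω)) with ht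
  have hq0 : ∀ x, 0 ≤ q x := probOf_nonneg hp.1 _
  have hr0 : ∀ x, 0 ≤ r x := probOf_nonneg hp.1 _
  have hs0 : ∀ x, 0 ≤ s x := probOf_nonneg hp.1 _
  have ht0 : ∀ x, 0 ≤ t x := probOf_nonneg hp.1 _
  let F : α × β × γ → ℝ := fun x => s (x.1, x.2.2) * t x.2 / (q x * r x.2.2)
  have hF : ∑ ω, p ω * F (A ω, B ω, C ω) ≤ 1 := by
    calc ∑ ω, p ω * F (A ω, B ω, C ω) = ∑ x, q x * F x := (sum_probOf_mul p _ F).symm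
      _ ≤ ∑ x : α × β × γ, s (x.1, x.2.2) * t x.2 / r x.2.2 := by
        refine Finset.sum_le_sum fun x _ => ?_
        have h0 : 0 ≤ s (x.1, x.2.2) * t x.2 / r x.2.2 :=
          div_nonneg (mul_nonneg (hs0 _) (ht0 _)) (hr0 _)
        rcases (hq0 x).eq_or_lt with h | h
        · simpa [← h] using h0
        · refine le_of_eq ?_
          simp only [F]
          rw [← div_div, div_right_comm, mul_div_cancel₀ _ h.ne']
      _ = ∑ c, r c := by
        simp only [Fintype.sum_prod_type]
        rw [Finset.sum_congr rfl fun a _ => Finset.sum_comm, Finset.sum_comm]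
        refine Finset.sum_congr rfl fun c _ => ?_
        have h1 : ∑ a, s (a, c) = r c := sum_probOf_prodMk p A C c
        have h2 : ∑ b, t (b, c) = r c := sum_probOf_prodMk p B C c
        simp only [← Finset.sum_div, ← Finset.mul_sum, ← Finset.sum_mul, h1, h2, mul_self_div_self]
      _ = 1 := (sum_probOf p C).trans hp.2
  have hlog : ∑ ω, p ω * (Real.log (s (A ω, C ω)) + Real.log (t (B ω, C ω))
      - Real.log (q (A ω, B ω, C ω)) - Real.log (r (C ω))) ≤
      ∑ ω, (p ω * F (A ω, B ω, C ω) - p ω) := by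
    refine Finset.sum_le_sum fun ω _ => ?_
    rcases (hp.1 ω).eq_or_lt with h | h
    · simp [← h]
    have hq1 : 0 < q (A ω, B ω, C ω) := probOf_apply_pos hp.1 (fun ω => (A ω, B ω, C ω)) h
    have hr1 : 0 < r (C ω) := probOf_apply_pos hp.1 C h
    have hs1 : 0 < s (A ω, C ω) := probOf_apply_pos hp.1 (fun ω => (A ω, C ω)) h
    have ht1 : 0 < t (B ω, C ω) := probOf_apply_pos hp.1 (fun ω => (B ω, C ω)) h
    have hFlog : Real.log (F (A ω, B ω, C ω)) ≤ F (A ω, B ω, C ω) - 1 :=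
      Real.log_le_sub_one_of_pos (by positivity)
    have hexp : Real.log (F (A ω, B ω, C ω)) = Real.log (s (A ω, C ω)) + Real.log (t (B ω, C ω))
        - Real.log (q (A ω, B ω, C ω)) - Real.log (r (C ω)) := by
      simp only [F]
      rw [Real.log_div (by positivity) (by positivity), Real.log_mul hs1.ne' ht1.ne',
        Real.log_mul hq1.ne' hr1.ne']
      ring
    rw [← hexp]
    nlinarith
  simp only [mul_sub, mul_add, Finset.sum_sub_distrib, Finset.sum_add_distrib, hp.2] at hlog
  simp only [Hent_eq_sum, ← hq, ← hr, ← hs, ← ht]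
  linarith

/-- Subfamilies of a mutually independent family have product distributions. -/
theorem MutIndep.probOf_tup {Ω ι : Type} [Fintype Ω] [Fintype ι] [DecidableEq ι] {𝒳 : ι → Type}
    [∀ k, Fintype (𝒳 k)] {p : Ω → ℝ} (hp : IsPMF p) {X : ∀ k, Ω → 𝒳 k} (hind : MutIndep p X)
    (A : Finset ι) (x : ∀ k, 𝒳 k) :
    probOf p (tup X A) (fun k : A => x k.1) = ∏ k ∈ A, probOf p (X k) (x k) := by
  let t : ∀ k, Finset (𝒳 k) := fun k => if k ∈ A then {x k} else Finset.univ
  have hmem : ∀ ω, tup X A ω = (fun k : A => x k.1) ↔ (fun k => X k ω) ∈ Fintype.piFinset t := by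
    intro ω
    simp only [tup, funext_iff, Subtype.forall, Fintype.mem_piFinset, t]
    refine forall_congr' fun k => ?_
    by_cases h : k ∈ A <;> simp [h]
  calc probOf p (tup X A) (fun k : A => x k.1)
      = ∑ y ∈ Fintype.piFinset t, probOf p (fun ω k => X k ω) y := by
        simp only [probOf, hmem]
        rw [Finset.sum_comm]
        refine Finset.sum_congr rfl fun ω _ => ?_
        convert (Finset.sum_ite_eq (Fintype.piFinset t) (fun k => X k ω) fun _ => p ω).symm
    _ = ∏ k, ∑ y ∈ t k, probOf p (X k) y := by
        rw [Finset.prod_univ_sum]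
        exact Finset.sum_congr rfl fun y _ => hind y
    _ = ∏ k ∈ A, probOf p (X k) (x k) := by
        rw [← Finset.prod_subset (Finset.subset_univ A)]
        · exact Finset.prod_congr rfl fun k hk => by simp [t, hk]
        · intro k _ hk
          simp [t, hk, sum_probOf, hp.2]

theorem MutIndep.Hent_tup {Ω ι : Type} [Fintype Ω] [Fintype ι] [DecidableEq ι] {𝒳 : ι → Type}
    [∀ k, Fintype (𝒳 k)] {p : Ω → ℝ} (hp : IsPMF p) {X : ∀ k, Ω → 𝒳 k} (hind : MutIndep p X)
    (A : Finset ι) : Hent p (tup X A) = ∑ k ∈ A, Hent p (X k) := by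
  simp only [Hent_eq_sum, Finset.sum_neg_distrib]
  rw [Finset.sum_comm]
  congr 1
  refine Finset.sum_congr rfl fun ω _ => ?_
  rw [← Finset.mul_sum]
  rcases (hp.1 ω).eq_or_lt with h | h
  · simp [← h]
  rw [← Real.log_prod fun k _ => (probOf_apply_pos hp.1 (X k) h).ne',
    ← hind.probOf_tup hp A fun k => X k ω]
  rfl

theorem tup_eq_tup_iff {Ω ι : Type} {𝒳 : ι → Type} (X : ∀ k, Ω → 𝒳 k) (A : Finset ι) (ω ω' : Ω) :
    tup X A ω = tup X A ω' ↔ ∀ k ∈ A, X k ω = X k ω' := by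
  simp [tup, funext_iff]

theorem Hent_tup_prodMk_submodular {Ω ι ζ : Type} [Fintype Ω] [DecidableEq ι] {𝒳 : ι → Type}
    [∀ k, Fintype (𝒳 k)] [Fintype ζ] {p : Ω → ℝ} (hp : IsPMF p) (X : ∀ k, Ω → 𝒳 k) (Z : Ω → ζ)
    (P Q : Finset ι) :
    Hent p (fun ω => (tup X (P ∪ Q) ω, Z ω)) + Hent p (fun ω => (tup X (P ∩ Q) ω, Z ω)) ≤
      Hent p (fun ω => (tup X P ω, Z ω)) + Hent p (fun ω => (tup X Q ω, Z ω)) := by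
  convert Hent_submodular hp (tup X P) (tup X Q) (fun ω => (tup X (P ∩ Q) ω, Z ω)) using 2
  all_goals
    refine Hent_congr p fun ω ω' => ?_
    simp only [Prod.mk.injEq, tup_eq_tup_iff, Finset.mem_union, Finset.mem_inter]
    grind

/-- Conditioning on more variables, all independent of `X_D`, does not decrease the information
that `X_D` carries about `Z`. -/
theorem MutIndep.IcondMut_tup_add_Imut_tup_le {Ω ι ζ : Type} [Fintype Ω] [Fintype ι]
    [DecidableEq ι] {𝒳 : ι → Type} [∀ k, Fintype (𝒳 k)] [Fintype ζ] {p : Ω → ℝ} (hp : IsPMF p)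
    {X : ∀ k, Ω → 𝒳 k} (hind : MutIndep p X) (Z : Ω → ζ) {D T V : Finset ι}
    (hTV : T ⊆ V) (hDV : Disjoint D V) :
    IcondMut p (tup X D) Z (tup X T) + Imut p (tup X V) Z ≤ Imut p (tup X (D ∪ V)) Z := by
  have hsub := Hent_tup_prodMk_submodular hp X Z (D ∪ T) V
  rw [Finset.union_assoc, Finset.union_eq_right.2 hTV, Finset.union_inter_distrib_right,
    Finset.disjoint_iff_inter_eq_empty.1 hDV, Finset.empty_union,
    Finset.inter_eq_left.2 hTV] at hsub
  have hDT : Hent p (fun ω => (tup X D ω, tup X T ω)) = Hent p (tup X (D ∪ T)) :=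
    Hent_congr p fun ω ω' => by
      simp only [Prod.mk.injEq, tup_eq_tup_iff, Finset.mem_union]
      grind
  have hZT : Hent p (fun ω => (Z ω, tup X T ω)) = Hent p (fun ω => (tup X T ω, Z ω)) :=
    Hent_congr p fun ω ω' => by
      simp only [Prod.mk.injEq]
      grind
  have hDZT : Hent p (fun ω => ((tup X D ω, Z ω), tup X T ω)) =
      Hent p (fun ω => (tup X (D ∪ T) ω, Z ω)) :=
    Hent_congr p fun ω ω' => by
      simp only [Prod.mk.injEq, tup_eq_tup_iff, Finset.mem_union]
      grind
  have hT := hind.Hent_tup hp (D ∪ T)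
  have hV := hind.Hent_tup hp (D ∪ V)
  rw [Finset.sum_union (hDV.mono_right hTV), ← hind.Hent_tup hp, ← hind.Hent_tup hp] at hT
  rw [Finset.sum_union hDV, ← hind.Hent_tup hp, ← hind.Hent_tup hp] at hV
  simp only [IcondMut, condHent, Imut]
  linarith

theorem stmt15 {K : ℕ} (hK : 1 ≤ K) {Ω : Type} [Fintype Ω]
    {𝒳 : Fin (K + 1) → Type} [∀ k, Fintype (𝒳 k)] {𝒵 : Type} [Fintype 𝒵]
    (p : Ω → ℝ) (hp : IsPMF p)
    (X : ∀ k, Ω → 𝒳 k) (Z : Ω → 𝒵) (hind : MutIndep p X)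
    (S S₁ S' S₁' : Finset (Fin (K + 1)))
    (hS : S ⊆ Finset.univ.erase (Fin.last K))
    (hS₁ : S₁ ⊆ Finset.univ.erase (Fin.last K))
    (hS' : S' ⊆ S) (hS₁' : S₁' ⊆ S₁) :
    IcondMut p (tup X (insert (Fin.last K) ((S' ∩ (S \ S₁)) ∪ ((S' ∩ S₁) \ S₁')))) Z
        (tup X (S' \ ((S' ∩ (S \ S₁)) ∪ ((S' ∩ S₁) \ S₁')))) +
      Imut p (tup X S₁') Z ≤
    Imut p (tup X (insert (Fin.last K) (S₁' ∪ ((S' ∩ (S \ S₁)) ∪ ((S' ∩ S₁) \ S₁'))))) Z := by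
  have hlast : Fin.last K ∉ S₁ := fun h => by simpa using hS₁ h
  have hDV : Disjoint (insert (Fin.last K) ((S' ∩ (S \ S₁)) ∪ ((S' ∩ S₁) \ S₁'))) S₁' := by
    rw [Finset.disjoint_left]
    grind
  have hTV : S' \ ((S' ∩ (S \ S₁)) ∪ ((S' ∩ S₁) \ S₁')) ⊆ S₁' := by
    grind
  rw [Finset.union_comm S₁', ← Finset.insert_union _ _ S₁']
  exact hind.IcondMut_tup_add_Imut_tup_le hp Z hTV hDV
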